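/- arXiv:0809.4250 — 3 statements merged into one kernel-verified Lean document; each statement's English description precedes it below -/
import Mathlib

section
/- Let (G,B) be a planted graph on vertex set V and let K ⊆ V. Let r(K) denote the maximum number of paths in a routing from K to B in (G,B) (the maximum number of pairwise vertex-disjoint directed paths each starting in K and ending in B, where paths of length zero from vertices of K ∩ B are allowed). Then there exists a planted graph (G',B') obtained from (G,B) by a finite sequence of swap operations (hence with the same routable sets) such that |K ∩ B'| = r(K). -/
/-- `(G, B)` (with edge relation `E`) is a planted graph: `G` has no loops
(and, being given by a relation, no parallel edges) and every vertex of `B`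
is a sink of `G`. -/
def IsPlanted {V : Type*} (E : V → V → Prop) (B : Finset V) : Prop :=
  (∀ v, ¬ E v v) ∧ ∀ b ∈ B, ∀ v, ¬ E b v

/-- `A` is routable to `B` in the directed graph with edge relation `E`:
there is a family of pairwise vertex-disjoint directed paths (one ending at each
vertex of `B`, possibly of length zero) whose set of initial vertices is `A`. -/
def Routable {V : Type*} (E : V → V → Prop) (B A : Finset V) : Prop :=
  ∃ f : V → List V,
    (∀ b ∈ B, (f b).Chain' E ∧ (f b).Nodup ∧ (f b).getLast? = some b) ∧
    (∀ b ∈ B, ∀ c ∈ B, b ≠ c → ∀ v, v ∈ f b → v ∉ f c) ∧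
    (∀ a : V, a ∈ A ↔ ∃ b ∈ B, (f b).head? = some a)

/-- There exist `m` pairwise vertex-disjoint directed paths (possibly of length
zero) in the graph with edge relation `E`, each starting at a vertex of `K` and
ending at a vertex of `B`. -/
def PathsKtoB {V : Type*} (E : V → V → Prop) (B K : Finset V) (m : ℕ) : Prop :=
  ∃ f : Fin m → List V,
    (∀ t, (f t).Chain' E ∧ (f t).Nodup ∧
      (∃ a ∈ K, (f t).head? = some a) ∧ (∃ b ∈ B, (f t).getLast? = some b)) ∧
    (∀ s t : Fin m, s ≠ t → ∀ v, v ∈ f s → v ∉ f t)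

/-- The edge relation of the graph obtained from `E` by `swap(i,j)`:
the edge `e_{ij}` is replaced by `e_{ji}`, every other edge `e_{ik}` out of `i`
is replaced by `e_{jk}`, and all other edges are unchanged. -/
def swapGraph {V : Type*} (E : V → V → Prop) (i j : V) : V → V → Prop :=
  fun x y => (x ≠ i ∧ x ≠ j ∧ E x y) ∨ (x = j ∧ (y = i ∨ (E i y ∧ y ≠ j)))

/-- The planted graph `(E', B')` is obtained from `(E, B)` by a single swap
operation `swap(i,j)` for some `i ∉ B`, `j ∈ B` with `e_{ij} ∈ E`. -/
def SwapStep {V : Type*} [DecidableEq V]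
    (p q : (V → V → Prop) × Finset V) : Prop :=
  ∃ i j : V, i ∉ p.2 ∧ j ∈ p.2 ∧ p.1 i j ∧
    (∀ x y, q.1 x y ↔ swapGraph p.1 i j x y) ∧ q.2 = insert i (p.2.erase j)

theorem List.IsChain.getLast?_eq_of_mem_sink {V : Type*} {E : V → V → Prop} {b : V}
    (hb : ∀ v, ¬ E b v) {l : List V} (hl : l.IsChain E) (hm : b ∈ l) :
    l.getLast? = some b := by
  induction l with
  | nil => simp at hm
  | cons a l ih =>
    cases l with
    | nil => simp_all
    | cons c l =>
      rw [List.isChain_cons_cons] at hl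
      rw [List.getLast?_cons_cons]
      refine ih hl.2 ?_
      rcases List.mem_cons.1 hm with rfl | h
      · exact absurd hl.1 (hb c)
      · exact h

theorem List.IsChain.swapGraph_of_notMem_dropLast {V : Type*} {E : V → V → Prop} {i j : V}
    (hj : ∀ v, ¬ E j v) {l : List V} (hl : l.IsChain E) (hi : i ∉ l.dropLast) :
    l.IsChain (swapGraph E i j) := by
  induction l with
  | nil => simp
  | cons a l ih =>
    cases l with
    | nil => simp
    | cons c l =>
      rw [List.isChain_cons_cons] at hl ⊢
      rw [List.dropLast_cons_cons, List.mem_cons, not_or] at hi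
      refine ⟨Or.inl ⟨Ne.symm hi.1, ?_, hl.1⟩, ih hl.2 hi.2⟩
      rintro rfl
      exact hj c hl.1

theorem IsPlanted.swapGraph {V : Type*} [DecidableEq V] {E : V → V → Prop} {B : Finset V}
    (h : IsPlanted E B) {i j : V} (hij : E i j) :
    IsPlanted (swapGraph E i j) (insert i (B.erase j)) := by
  have hne : i ≠ j := by rintro rfl; exact h.1 _ hij
  refine ⟨fun v hv => ?_, fun b hb v hv => ?_⟩
  · rcases hv with ⟨_, _, hv⟩ | ⟨rfl, hv | hv⟩
    · exact h.1 v hv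
    · exact hne hv.symm
    · exact hv.2 rfl
  · rw [Finset.mem_insert, Finset.mem_erase] at hb
    rcases hv with ⟨h1, h2, hv⟩ | ⟨rfl, _⟩
    · rcases hb with rfl | hb
      · exact h1 rfl
      · exact h.2 b hb.2 v hv
    · rcases hb with rfl | hb
      · exact hne rfl
      · exact hb.1 rfl

theorem IsPlanted.swapGraph_swapGraph {V : Type*} {E : V → V → Prop} {B : Finset V}
    (h : IsPlanted E B) {i j : V} (hj : j ∈ B) (hij : E i j) :
    _root_.swapGraph (_root_.swapGraph E i j) j i = E := by
  have hne : i ≠ j := by rintro rfl; exact h.1 _ hij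
  have h1 := h.1 i
  have h2 := h.2 j hj
  funext x y
  apply propext
  unfold _root_.swapGraph
  by_cases hx : x = i <;> by_cases hx' : x = j <;> by_cases hy : y = i <;>
    by_cases hy' : y = j <;> simp_all

theorem disjoint_update {V : Type*} [DecidableEq V] {B : Finset V} {f : V → List V}
    (hd : ∀ b ∈ B, ∀ c ∈ B, b ≠ c → ∀ v ∈ f b, v ∉ f c) {i : V} {L : List V}
    (hL : ∀ b ∈ B, b ≠ i → ∀ v ∈ L, v ∉ f b) :
    ∀ b ∈ insert i B, ∀ c ∈ insert i B, b ≠ c →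
      ∀ v ∈ Function.update f i L b, v ∉ Function.update f i L c := by
  intro b hb c hc hbc v hv hv'
  by_cases hbi : b = i
  · have hci : c ≠ i := fun h => hbc (hbi.trans h.symm)
    rw [hbi, Function.update_self] at hv
    rw [Function.update_of_ne hci] at hv'
    exact hL c (Finset.mem_of_mem_insert_of_ne hc hci) hci v hv hv'
  · rw [Function.update_of_ne hbi] at hv
    have hb' := Finset.mem_of_mem_insert_of_ne hb hbi
    by_cases hci : c = i
    · rw [hci, Function.update_self] at hv'
      exact hL b hb' hbi v hv' hv
    · rw [Function.update_of_ne hci] at hv'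
      exact hd b hb' c (Finset.mem_of_mem_insert_of_ne hc hci) hbc v hv hv'

theorem IsPlanted.routable_swapGraph {V : Type*} [DecidableEq V] {E : V → V → Prop}
    {B : Finset V} (h : IsPlanted E B) {i j : V} (hi : i ∉ B) (hj : j ∈ B) (hij : E i j)
    {A : Finset V} (hA : Routable E B A) :
    Routable (_root_.swapGraph E i j) (insert i (B.erase j)) A := by
  obtain ⟨f, hf, hd, hh⟩ := hA
  have hne : i ≠ j := by rintro rfl; exact h.1 _ hij
  have hs := h.2 j hj
  have hchain : ∀ b ∈ B, i ∉ f b → (f b).IsChain (_root_.swapGraph E i j) := fun b hb hib =>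
    (hf b hb).1.swapGraph_of_notMem_dropLast hs fun hm => hib (List.mem_of_mem_dropLast hm)
  have hnil : ∀ b ∈ B, f b ≠ [] := by
    intro b hb h0
    simpa [h0] using (hf b hb).2.2
  have hd' : ∀ b ∈ B.erase j, ∀ c ∈ B.erase j, b ≠ c → ∀ v ∈ f b, v ∉ f c := fun b hb c hc =>
    hd b (Finset.mem_of_mem_erase hb) c (Finset.mem_of_mem_erase hc)
  by_cases hc : ∃ c ∈ B, i ∈ f c
  · obtain ⟨c, hcB, hic⟩ := hc
    have hic' : i ≠ c := by rintro rfl; exact hi hcB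
    have honly : ∀ b ∈ B, b ≠ c → i ∉ f b := fun b hb hbc hib => hd b hb c hcB hbc i hib hic
    obtain ⟨Q, R, hQR⟩ := List.append_of_mem hic
    have hfc := hf c hcB
    rw [hQR] at hfc
    obtain ⟨hch, hnd, hlast⟩ := hfc
    have hQi : (Q ++ [i]).IsChain (_root_.swapGraph E i j) := by
      refine List.IsChain.swapGraph_of_notMem_dropLast hs ?_ ?_
      · refine hch.prefix ⟨R, by simp⟩
      · simp; grind
    by_cases hcj : c = j
    · subst hcj
      refine ⟨Function.update f i (Q ++ [i]), ?_, ?_, ?_⟩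
      · intro b hb
        by_cases hbi : b = i
        · subst hbi
          simp only [Function.update_self]
          refine ⟨hQi, by grind, by simp⟩
        · rw [Function.update_of_ne hbi]
          have hbB : b ∈ B := by grind
          exact ⟨hchain b hbB (honly b hbB (by grind)), (hf b hbB).2⟩
      · refine disjoint_update hd' fun b hb _ v hv => hd c hcB b (Finset.mem_of_mem_erase hb)
          (Finset.ne_of_mem_erase hb).symm v ?_
        rw [hQR]
        simp at hv ⊢; tauto
      · intro a
        rw [hh]
        constructor
        · rintro ⟨b, hb, hba⟩
          by_cases hbc : b = c
          · subst hbc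
            exact ⟨i, by simp, by rw [Function.update_self]; rw [hQR] at hba; cases Q <;> simpa using hba⟩
          · exact ⟨b, by grind, by rw [Function.update_of_ne (by grind)]; exact hba⟩
        · rintro ⟨b, hb, hba⟩
          by_cases hbi : b = i
          · subst hbi
            refine ⟨c, hj, ?_⟩
            rw [Function.update_self] at hba
            rw [hQR]; cases Q <;> simpa using hba
          · exact ⟨b, by grind, by rwa [Function.update_of_ne hbi] at hba⟩
    · cases R with
      | nil => simp at hlast; exact absurd hlast hic'
      | cons k R =>
      have hjfc : j ∉ f c := fun hm => by
        have := (hf c hcB).1.getLast?_eq_of_mem_sink hs hm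
        rw [(hf c hcB).2.2] at this
        exact hcj (by simpa using this)
      have hik : E i k := by
        have h3 : (i :: k :: R).IsChain E := hch.suffix ⟨Q, rfl⟩
        exact (List.isChain_cons_cons.1 h3).1
      have hkR : (k :: R).IsChain (_root_.swapGraph E i j) := by
        refine List.IsChain.swapGraph_of_notMem_dropLast hs (hch.suffix ⟨Q ++ [i], by simp⟩) ?_
        intro hm
        have := List.mem_of_mem_dropLast hm
        grind
      have hjnew : (f j ++ k :: R).IsChain (_root_.swapGraph E i j) := by
        refine List.IsChain.append (hchain j hj (honly j hj (Ne.symm hcj))) hkR ?_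
        intro x hx y hy
        rw [(hf j hj).2.2] at hx
        simp at hx hy
        subst hx hy
        exact Or.inr ⟨rfl, Or.inr ⟨hik, by rintro rfl; exact hjfc (by simp [hQR])⟩⟩
      have hdj := hd j hj c hcB (Ne.symm hcj)
      have hndj := (hf j hj).2.1
      refine ⟨Function.update (Function.update f c (f j ++ k :: R)) i (Q ++ [i]), ?_, ?_, ?_⟩
      · intro b hb
        by_cases hbi : b = i
        · subst hbi
          simp only [Function.update_self]
          refine ⟨hQi, by grind, by simp⟩
        · rw [Function.update_of_ne hbi]
          by_cases hbc : b = c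
          · subst hbc
            rw [Function.update_self]
            refine ⟨hjnew, ?_, by simpa using hlast⟩
            rw [List.nodup_append']
            refine ⟨hndj, by grind, ?_⟩
            intro v hv hv'
            exact hdj v hv (by rw [hQR]; grind)
          · rw [Function.update_of_ne hbc]
            have hbB : b ∈ B := by grind
            exact ⟨hchain b hbB (honly b hbB hbc), (hf b hbB).2⟩
      · have hQ : ∀ v ∈ Q ++ [i], v ∈ f c := by
          rw [hQR]
          simp; grind
        have hR : ∀ v ∈ k :: R, v ∈ f c ∧ v ∉ Q ++ [i] := by
          rw [hQR]
          grind
        have hR' : ∀ b ∈ B.erase j, b ≠ c → ∀ v ∈ f j ++ k :: R, v ∉ f b := by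
          intro b hb hbc v hv hvb
          obtain ⟨hbj, hbB⟩ := Finset.mem_erase.1 hb
          rcases List.mem_append.1 hv with hv | hv
          · exact hd j hj b hbB (Ne.symm hbj) v hv hvb
          · exact hd b hbB c hcB hbc v hvb (hR v hv).1
        have hdc := disjoint_update hd' hR'
        rw [Finset.insert_eq_of_mem (Finset.mem_erase.2 ⟨hcj, hcB⟩)] at hdc
        refine disjoint_update hdc fun b hb hbi v hv hvb => ?_
        obtain ⟨hbj, hbB⟩ := Finset.mem_erase.1 hb
        by_cases hbc : b = c
        · rw [hbc, Function.update_self, List.mem_append] at hvb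
          exact hvb.elim (fun h => hdj v h (hQ v hv)) fun h => (hR v h).2 hv
        · rw [Function.update_of_ne hbc] at hvb
          exact hd b hbB c hcB hbc v hvb (hQ v hv)
      · intro a
        rw [hh]
        have hhead : (Q ++ [i]).head? = (f c).head? := by
          rw [hQR]; cases Q <;> simp
        have hhead' : (f j ++ k :: R).head? = (f j).head? := by
          have := hnil j hj
          cases hfj : f j <;> simp_all
        constructor
        · rintro ⟨b, hb, hba⟩
          by_cases hbc : b = c
          · subst hbc
            exact ⟨i, by simp, by rw [Function.update_self, hhead]; exact hba⟩
          · by_cases hbj : b = j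
            · subst hbj
              exact ⟨c, by grind, by
                rw [Function.update_of_ne (by grind), Function.update_self, hhead']; exact hba⟩
            · exact ⟨b, by grind, by
                rw [Function.update_of_ne (by grind), Function.update_of_ne hbc]; exact hba⟩
        · rintro ⟨b, hb, hba⟩
          by_cases hbi : b = i
          · subst hbi
            exact ⟨c, hcB, by rwa [Function.update_self, hhead] at hba⟩
          · rw [Function.update_of_ne hbi] at hba
            by_cases hbc : b = c
            · subst hbc
              exact ⟨j, hj, by rwa [Function.update_self, hhead'] at hba⟩
            · exact ⟨b, by grind, by rwa [Function.update_of_ne hbc] at hba⟩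
  · push Not at hc
    have hhead : (f j ++ [i]).head? = (f j).head? := by
      have := hnil j hj
      cases hfj : f j <;> simp_all
    refine ⟨Function.update f i (f j ++ [i]), ?_, ?_, ?_⟩
    · intro b hb
      by_cases hbi : b = i
      · subst hbi
        simp only [Function.update_self]
        refine ⟨?_, ?_, by simp⟩
        · refine List.IsChain.append (hchain j hj (hc j hj)) (by simp) ?_
          intro x hx y hy
          rw [(hf j hj).2.2] at hx
          simp at hx hy
          subst hx hy
          exact Or.inr ⟨rfl, Or.inl rfl⟩
        · have := (hf j hj).2.1
          have := hc j hj
          grind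
      · rw [Function.update_of_ne hbi]
        have hbB : b ∈ B := by grind
        exact ⟨hchain b hbB (hc b hbB), (hf b hbB).2⟩
    · refine disjoint_update hd' fun b hb _ v hv => ?_
      obtain ⟨hbj, hbB⟩ := Finset.mem_erase.1 hb
      rcases List.mem_append.1 hv with hv | hv
      · exact hd j hj b hbB hbj.symm v hv
      · exact List.mem_singleton.1 hv ▸ hc b hbB
    · intro a
      rw [hh]
      constructor
      · rintro ⟨b, hb, hba⟩
        by_cases hbc : b = j
        · subst hbc
          exact ⟨i, by simp, by rw [Function.update_self, hhead]; exact hba⟩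
        · exact ⟨b, by grind, by rw [Function.update_of_ne (by grind)]; exact hba⟩
      · rintro ⟨b, hb, hba⟩
        by_cases hbi : b = i
        · subst hbi
          exact ⟨j, hj, by rwa [Function.update_self, hhead] at hba⟩
        · exact ⟨b, by grind, by rwa [Function.update_of_ne hbi] at hba⟩

theorem SwapStep.isPlanted_and_routable_iff {V : Type*} [DecidableEq V]
    {p q : (V → V → Prop) × Finset V} (hpq : SwapStep p q) (h : IsPlanted p.1 p.2) :
    IsPlanted q.1 q.2 ∧ ∀ A, Routable q.1 q.2 A ↔ Routable p.1 p.2 A := by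
  obtain ⟨E, B⟩ := p
  obtain ⟨E', B'⟩ := q
  obtain ⟨i, j, hi, hj, hij, hE, hB⟩ := hpq
  dsimp only at *
  obtain rfl : E' = swapGraph E i j := by
    funext x y
    exact propext (hE x y)
  subst hB
  have hne : i ≠ j := by rintro rfl; exact h.1 _ hij
  have hP := h.swapGraph hij
  refine ⟨hP, fun A => ⟨fun hA => ?_, h.routable_swapGraph hi hj hij⟩⟩
  have hback := hP.routable_swapGraph (i := j) (j := i) (by grind) (by simp)
    (Or.inr ⟨rfl, Or.inl rfl⟩) hA
  rw [h.swapGraph_swapGraph hj hij] at hback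
  convert hback using 1
  grind

theorem isPlanted_and_routable_iff_of_reflTransGen {V : Type*} [DecidableEq V]
    {p q : (V → V → Prop) × Finset V} (hpq : Relation.ReflTransGen SwapStep p q)
    (h : IsPlanted p.1 p.2) :
    IsPlanted q.1 q.2 ∧ ∀ A, Routable q.1 q.2 A ↔ Routable p.1 p.2 A := by
  induction hpq with
  | refl => exact ⟨h, fun _ => Iff.rfl⟩
  | tail _ hs ih =>
    obtain ⟨h1, h2⟩ := hs.isPlanted_and_routable_iff ih.1
    exact ⟨h1, fun A => (h2 A).trans (ih.2 A)⟩

theorem IsPlanted.exists_swaps_along_path {V : Type*} [DecidableEq V] {E : V → V → Prop}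
    {B : Finset V} (h : IsPlanted E B) {w : V} (hw : w ∈ B) (l : List V) (v : V)
    (hl : (v :: l).IsChain E) (hnd : (v :: l).Nodup) (hlast : (v :: l).getLast? = some w) :
    ∃ E' : V → V → Prop,
      Relation.ReflTransGen SwapStep (E, B) (E', insert v (B.erase w)) ∧
      ∀ x, x ∉ v :: l → ∀ y, E x y → E' x y := by
  induction l generalizing v with
  | nil =>
    obtain rfl : v = w := by simpa using hlast
    exact ⟨E, by rw [Finset.insert_erase hw], fun _ _ _ => id⟩
  | cons u l ih =>
    have hvu := (List.isChain_cons_cons.1 hl).1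
    have hul := (List.isChain_cons_cons.1 hl).2
    rw [List.getLast?_cons_cons] at hlast
    obtain ⟨hvn, hnd'⟩ := List.nodup_cons.1 hnd
    obtain ⟨E', hE', hkeep⟩ := ih u hul hnd' hlast
    have hvB : v ∉ B := fun hv => h.2 v hv u hvu
    have huB : u ∉ B.erase w := by
      intro hu
      rw [Finset.mem_erase] at hu
      have := hul.getLast?_eq_of_mem_sink (h.2 u hu.2) (by simp)
      rw [hlast] at this
      exact hu.1 (by simpa using this.symm)
    refine ⟨_root_.swapGraph E' v u, hE'.tail ⟨v, u, ?_, by simp, hkeep v hvn u hvu,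
      fun _ _ => Iff.rfl, ?_⟩, ?_⟩
    · grind
    · dsimp only
      rw [Finset.erase_insert huB]
    · intro x hx y hxy
      exact Or.inl ⟨by grind, by grind, hkeep x (by grind) y hxy⟩

theorem IsPlanted.exists_routable_of_pathsKtoB {V : Type*} [DecidableEq V] {E : V → V → Prop}
    {B : Finset V} (h : IsPlanted E B) {K : Finset V} {m : ℕ} (hm : PathsKtoB E B K m) :
    ∃ A, Routable E B A ∧ m ≤ (K ∩ A).card := by
  classical
  obtain ⟨f, hf, hd⟩ := hm
  choose hch hnd hs ht using hf
  choose s hsK hs using hs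
  choose e heB he using ht
  have hlast : ∀ t, ∀ b ∈ B, b ∈ f t → b = e t := by
    intro t b hb hbt
    have := (hch t).getLast?_eq_of_mem_sink (h.2 b hb) hbt
    rw [he t] at this
    simpa using this.symm
  have hmem : ∀ t, e t ∈ f t := fun t => List.mem_of_getLast? (he t)
  have hsmem : ∀ t, s t ∈ f t := fun t => List.mem_of_head? (hs t)
  have heinj : Function.Injective e := by
    intro t t' htt
    by_contra hne
    exact hd t t' hne _ (hmem t) (htt ▸ hmem t')
  have hsinj : Function.Injective s := by
    intro t t' htt
    by_contra hne
    exact hd t t' hne _ (hsmem t) (htt ▸ hsmem t')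
  let g : V → List V := fun b => if hb : ∃ t, e t = b then f hb.choose else [b]
  have hge : ∀ t, g (e t) = f t := by
    intro t
    have hb : ∃ t', e t' = e t := ⟨t, rfl⟩
    simp only [g, dif_pos hb]
    rw [heinj hb.choose_spec]
  have hgn : ∀ b, (¬ ∃ t, e t = b) → g b = [b] := fun b hb => dif_neg hb
  refine ⟨B.biUnion (fun b => (g b).head?.toFinset), ⟨g, ?_, ?_, ?_⟩, ?_⟩
  · intro b hb
    by_cases hbt : ∃ t, e t = b
    · obtain ⟨t, rfl⟩ := hbt
      rw [hge]
      exact ⟨hch t, hnd t, he t⟩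
    · rw [hgn b hbt]
      exact ⟨List.isChain_singleton b, by simp, by simp⟩
  · intro b hb c hc hbc v hv hv'
    by_cases hbt : ∃ t, e t = b <;> by_cases hct : ∃ t, e t = c
    · obtain ⟨t, rfl⟩ := hbt
      obtain ⟨t', rfl⟩ := hct
      rw [hge] at hv hv'
      exact hd t t' (fun h => hbc (h ▸ rfl)) v hv hv'
    · obtain ⟨t, rfl⟩ := hbt
      rw [hge] at hv
      rw [hgn c hct, List.mem_singleton] at hv'
      subst hv'
      exact hbc (hlast t v hc hv).symm
    · obtain ⟨t, rfl⟩ := hct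
      rw [hge] at hv'
      rw [hgn b hbt, List.mem_singleton] at hv
      subst hv
      exact hbc (hlast t v hb hv')
    · rw [hgn b hbt, List.mem_singleton] at hv
      rw [hgn c hct, List.mem_singleton] at hv'
      exact hbc (hv.symm.trans hv')
  · intro a
    simp
  · calc m = (Finset.univ.image s).card := by
          rw [Finset.card_image_of_injective _ hsinj]; simp
      _ ≤ _ := by
          refine Finset.card_le_card fun x hx => ?_
          obtain ⟨t, -, rfl⟩ := Finset.mem_image.1 hx
          simp only [Finset.mem_inter, hsK, true_and, Finset.mem_biUnion]
          exact ⟨e t, heB t, by rw [hge, hs]; simp⟩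

theorem Routable.pathsKtoB {V : Type*} [DecidableEq V] {E : V → V → Prop}
    {B A : Finset V} (hA : Routable E B A) (K : Finset V) :
    PathsKtoB E B K (K ∩ A).card := by
  obtain ⟨f, hf, hd, hh⟩ := hA
  have hex : ∀ t : Fin (K ∩ A).card, ∃ b ∈ B,
      (f b).head? = some ((K ∩ A).equivFin.symm t : V) := fun t =>
    (hh _).1 (Finset.mem_inter.1 ((K ∩ A).equivFin.symm t).2).2
  choose b hb hbh using hex
  refine ⟨fun t => f (b t), fun t => ⟨(hf _ (hb t)).1, (hf _ (hb t)).2.1,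
    ⟨_, (Finset.mem_inter.1 ((K ∩ A).equivFin.symm t).2).1, hbh t⟩,
    ⟨_, hb t, (hf _ (hb t)).2.2⟩⟩, fun t t' hne => hd _ (hb t) _ (hb t') fun hbb => hne ?_⟩
  have := hbh t
  rw [hbb, hbh t'] at this
  simpa [Subtype.ext_iff] using this.symm

theorem routable_self {V : Type*} (E : V → V → Prop) (B : Finset V) : Routable E B B :=
  ⟨fun b => [b], fun b _ => ⟨List.isChain_singleton b, by simp, by simp⟩, by grind, by simp⟩

theorem IsPlanted.exists_swaps_card_inter_lt {V : Type*} [DecidableEq V] {E : V → V → Prop}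
    {B : Finset V} (h : IsPlanted E B) {K : Finset V} {m : ℕ} (hm : PathsKtoB E B K m)
    (hlt : (K ∩ B).card < m) :
    ∃ (E' : V → V → Prop) (B' : Finset V),
      Relation.ReflTransGen SwapStep (E, B) (E', B') ∧ (K ∩ B).card < (K ∩ B').card := by
  obtain ⟨f, hf, hd⟩ := hm
  choose hch hnd hs ht using hf
  choose s hsK hs using hs
  choose e heB he using ht
  obtain ⟨t, hte⟩ : ∃ t, e t ∉ K := by
    by_contra! hall
    have heinj : Function.Injective e := by
      intro t t' htt
      by_contra hne
      exact hd t t' hne _ (List.mem_of_getLast? (he t)) (htt ▸ List.mem_of_getLast? (he t'))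
    have : (Finset.univ.image e).card ≤ (K ∩ B).card :=
      Finset.card_le_card fun x hx => by
        obtain ⟨t, -, rfl⟩ := Finset.mem_image.1 hx
        exact Finset.mem_inter.2 ⟨hall t, heB t⟩
    rw [Finset.card_image_of_injective _ heinj, Finset.card_univ, Fintype.card_fin] at this
    omega
  have hsB : s t ∉ B := fun hsB => by
    have := (hch t).getLast?_eq_of_mem_sink (h.2 _ hsB) (List.mem_of_head? (hs t))
    rw [he t, Option.some_inj] at this
    exact hte (this ▸ hsK t)
  obtain ⟨l, hl⟩ : ∃ l, f t = s t :: l := List.head?_eq_some_iff.1 (hs t)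
  obtain ⟨E', hE', -⟩ := h.exists_swaps_along_path (heB t) l (s t) (hl ▸ hch t) (hl ▸ hnd t)
    (hl ▸ he t)
  refine ⟨E', _, hE', Finset.card_lt_card ?_⟩
  rw [Finset.ssubset_iff]
  refine ⟨s t, by simp [hsB], fun x hx => ?_⟩
  have := hsK t
  grind

/-- Let `(G,B)` be a planted graph, `K ⊆ V`, and let `r(K)` be the maximum number
of paths in a routing from `K` to `B` (pairwise vertex-disjoint directed paths
starting in `K` and ending in `B`, length-zero paths allowed).  Then some planted
graph `(G',B')`, obtained from `(G,B)` by a finite sequence of swap operations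
(hence with the same routable sets), satisfies `|K ∩ B'| = r(K)`. -/
theorem swaps_reach_max_intersection {V : Type*} [DecidableEq V] [Fintype V]
    (E : V → V → Prop) (B : Finset V) (hPl : IsPlanted E B)
    (K : Finset V) (rK : ℕ)
    (hrK : IsGreatest {m : ℕ | PathsKtoB E B K m} rK) :
    ∃ (E' : V → V → Prop) (B' : Finset V),
      Relation.ReflTransGen (SwapStep (V := V)) (E, B) (E', B') ∧
      (∀ A : Finset V, Routable E' B' A ↔ Routable E B A) ∧
      (K ∩ B').card = rK := by
  induction hn : rK - (K ∩ B).card using Nat.strong_induction_on generalizing E B with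
  | _ n ih =>
    by_cases hlt : (K ∩ B).card < rK
    · obtain ⟨E', B', hstep, hcard⟩ := hPl.exists_swaps_card_inter_lt hrK.1 hlt
      obtain ⟨hP', hR⟩ := isPlanted_and_routable_iff_of_reflTransGen hstep hPl
      have hub : rK ∈ upperBounds {m : ℕ | PathsKtoB E' B' K m} := fun m hm => by
        obtain ⟨A, hA, hmA⟩ := hP'.exists_routable_of_pathsKtoB hm
        exact hmA.trans (hrK.2 (((hR A).1 hA).pathsKtoB K))
      have hmem : PathsKtoB E' B' K rK := by
        obtain ⟨A, hA, hmA⟩ := hPl.exists_routable_of_pathsKtoB hrK.1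
        have hp := ((hR A).2 hA).pathsKtoB K
        rwa [le_antisymm (hub hp) hmA] at hp
      obtain ⟨E'', B'', h1, h2, h3⟩ := ih _ (by omega) E' B' hP' ⟨hmem, hub⟩ rfl
      exact ⟨E'', B'', hstep.trans h1, fun A => (h2 A).trans (hR A), h3⟩
    · exact ⟨E, B, .refl, fun _ => Iff.rfl,
        le_antisymm (hrK.2 ((routable_self E B).pathsKtoB K)) (not_lt.1 hlt)⟩
end

section
/- Let (G,B) be a planted graph with at least one routable set, let M be the matroid on V whose bases are the routable sets of (G,B), and let K ⊆ V satisfy |K ∩ B| = r(K), where r(K) is the maximum number of pairwise vertex-disjoint directed paths from K to B. Let (G'',B'') be the planted graph obtained from (G,B) by deleting the vertices of K and all edges incident to them, with B'' = B − K. Then the routable sets of (G'',B'') are exactly the bases of the contraction M/K; in particular, M/K is cotransversal. -/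
section

variable {V : Type*}

/-! ### Transversal matroids -/

/-- `I` has a system of distinct representatives with respect to the relation `r`. -/
def Matchable (r : V → V → Prop) (I : Finset V) : Prop :=
  ∃ f : V → V, (∀ x ∈ I, r x (f x)) ∧ Set.InjOn f I

lemma matchable_empty (r : V → V → Prop) : Matchable r ∅ :=
  ⟨id, by simp, by simp⟩

lemma Matchable.subset {r : V → V → Prop} {I J : Finset V} (hJ : Matchable r J) (h : I ⊆ J) :
    Matchable r I := by
  obtain ⟨f, hf, hinj⟩ := hJ
  exact ⟨f, fun x hx => hf x (h hx), hinj.mono (by exact_mod_cast h)⟩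

lemma Matchable.augment [DecidableEq V] {r : V → V → Prop} {I J : Finset V} (hI : Matchable r I)
    (hJ : Matchable r J) (hlt : I.card < J.card) :
    ∃ e ∈ J, e ∉ I ∧ Matchable r (insert e I) := by
  obtain ⟨g, hg, ginj⟩ := hJ
  -- choose a matching of `I` agreeing with `g` as often as possible
  obtain ⟨f, ⟨hf, finj⟩, hmin⟩ := exists_minimalFor_of_wellFoundedLT
    (fun f : V → V => (∀ x ∈ I, r x (f x)) ∧ Set.InjOn f I)
    (fun f => (I.filter fun x => f x ≠ g x).card) hI
  have hcard : (I.image f).card < (J.image g).card := by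
    rwa [Finset.card_image_of_injOn finj, Finset.card_image_of_injOn ginj]
  obtain ⟨s, hsJ, hsI⟩ := Finset.exists_mem_notMem_of_card_lt_card hcard
  obtain ⟨e, heJ, rfl⟩ := Finset.mem_image.1 hsJ
  have hne : ∀ x ∈ I, f x ≠ g e := fun x hx h => hsI (Finset.mem_image.2 ⟨x, hx, h⟩)
  have hupd : ∀ x ∈ insert e I, r x (Function.update f e (g e) x) := by
    intro x hx
    by_cases hxe : x = e
    · subst hxe; simpa using hg x heJ
    · simpa [hxe] using hf x (by simpa [hxe] using hx)
  have hupdinj : Set.InjOn (Function.update f e (g e)) (insert e I : Finset V) := by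
    intro x hx y hy hxy
    simp only [Finset.coe_insert, Set.mem_insert_iff, Finset.mem_coe] at hx hy
    by_cases hxe : x = e <;> by_cases hye : y = e
    · rw [hxe, hye]
    · subst hxe
      simp only [Function.update_self, Function.update_of_ne hye] at hxy
      exact absurd hxy.symm (hne y (hy.resolve_left hye))
    · subst hye
      simp only [Function.update_self, Function.update_of_ne hxe] at hxy
      exact absurd hxy (hne x (hx.resolve_left hxe))
    · simp only [Function.update_of_ne hxe, Function.update_of_ne hye] at hxy
      exact finj (hx.resolve_left hxe) (hy.resolve_left hye) hxy
  by_cases heI : e ∈ I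
  · exfalso
    rw [Finset.insert_eq_of_mem heI] at hupd hupdinj
    have hlt' : (I.filter fun x => Function.update f e (g e) x ≠ g x).card <
        (I.filter fun x => f x ≠ g x).card := by
      apply Finset.card_lt_card
      rw [Finset.ssubset_iff_of_subset]
      · exact ⟨e, by simp [heI, hne e heI], by simp⟩
      · intro x hx
        by_cases hxe : x = e
        · subst hxe; simp at hx
        · simpa [hxe] using hx
    exact absurd (hmin ⟨hupd, hupdinj⟩ hlt'.le) (not_le.2 hlt')
  · exact ⟨e, heJ, heI, _, hupd, hupdinj⟩

/-- The transversal matroid of a relation. -/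
noncomputable def transversalMatroid [DecidableEq V] (r : V → V → Prop) : Matroid V :=
  (IndepMatroid.ofFinset Set.univ (Matchable r) (matchable_empty r)
    (fun _ _ hJ h => hJ.subset h) (fun _ _ hI hJ h => hI.augment hJ h)
    (fun _ _ => Set.subset_univ _)).matroid

@[simp] lemma transversalMatroid_E [DecidableEq V] (r : V → V → Prop) :
    (transversalMatroid r).E = Set.univ := rfl

@[simp] lemma transversalMatroid_indep [DecidableEq V] {r : V → V → Prop} {I : Finset V} :
    (transversalMatroid r).Indep I ↔ Matchable r I := by
  rw [transversalMatroid, IndepMatroid.matroid_Indep, IndepMatroid.ofFinset_indep]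

lemma isBase_congr_of_isBasis {M : Matroid V} {I J K A : Set V} (hI : M.IsBasis I K)
    (hJ : M.IsBasis J K) (hA : Disjoint K A) : M.IsBase (A ∪ I) ↔ M.IsBase (A ∪ J) := by
  suffices H : ∀ {I J : Set V}, M.IsBasis I K → M.IsBasis J K → M.IsBase (A ∪ I) →
      M.IsBase (A ∪ J) from ⟨H hI hJ, H hJ hI⟩
  intro I J hI hJ h
  have hind : M.Indep (A ∪ J) :=
    (hJ.contract_indep_iff.1 (hI.contract_indep_iff.2 ⟨h.indep, hA⟩)).1
  refine hind.isBase_of_spanning ?_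
  rw [M.spanning_iff_closure_eq hind.subset_ground, ← h.closure_eq]
  exact M.closure_union_congr_right (by rw [hI.closure_eq_closure, hJ.closure_eq_closure])

/-! ### Linkings and matchings -/

/-- In `linkRel E B x y`, `y` is a vertex outside `B` which equals `x` or has an edge to `x`. -/
def linkRel (E : V → V → Prop) (B : Finset V) (x y : V) : Prop :=
  y ∉ B ∧ (y = x ∨ E y x)

lemma card_eq_of_routable [DecidableEq V] {E : V → V → Prop} {A B : Finset V}
    (h : Routable E B A) : A.card = B.card := by
  obtain ⟨f, hf, hdis, hA⟩ := h
  symm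
  have hhead : ∀ b ∈ B, ∃ a, (f b).head? = some a := fun b hb => by
    have := (hf b hb).2.2
    cases hl : f b <;> simp_all
  choose! a ha using hhead
  have : A = B.image a := by
    ext x
    simp only [hA, Finset.mem_image]
    exact exists_congr fun b => and_congr_right fun hb => by rw [ha b hb, Option.some_inj]
  rw [this, Finset.card_image_of_injOn]
  intro b hb c hc hbc
  by_contra hne
  have h1 := List.mem_of_mem_head? (ha b hb)
  have h2 := List.mem_of_mem_head? (ha c hc)
  exact hdis b hb c hc hne _ h1 (hbc ▸ h2)

lemma eq_of_infix_pair {l : List V} (hl : l.Nodup) {p x y : V} (hx : [p, x] <:+: l)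
    (hy : [p, y] <:+: l) : x = y := by
  obtain ⟨s, t, rfl⟩ := hx
  obtain ⟨s', t', h⟩ := hy
  rw [← h] at hl
  simp only [List.append_assoc, List.cons_append, List.nil_append] at h hl
  have hp : p ∉ s' := fun hp => (List.nodup_append.1 hl).2.2 p hp p (by simp) rfl
  have hp' : p ∉ y :: t' := (List.nodup_cons.1 (List.nodup_append.1 hl).2.1).1
  have := ((List.append_cons_inj_of_notMem hp hp').1 h).2.2
  exact (List.cons_eq_cons.1 this).1.symm

lemma exists_infix_pair {l : List V} {x : V} (hx : x ∈ l) (hh : l.head? ≠ some x) :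
    ∃ p, [p, x] <:+: l := by
  obtain ⟨s, t, rfl⟩ := List.append_of_mem hx
  rcases List.eq_nil_or_concat s with rfl | ⟨s, p, rfl⟩
  · simp at hh
  · exact ⟨p, s, t, by simp⟩

lemma Routable.matchable_compl [DecidableEq V] [Fintype V] {E : V → V → Prop} {A B : Finset V}
    (hsink : ∀ b ∈ B, ∀ v, ¬ E b v) (h : Routable E B A) : Matchable (linkRel E B) Aᶜ := by
  obtain ⟨f, hf, hdis, hA⟩ := h
  have hpred : ∀ x, ∃ p, x ∉ A →
      (∃ b ∈ B, [p, x] <:+: f b) ∨ (p = x ∧ ∀ b ∈ B, x ∉ f b) := by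
    intro x
    by_cases hx : x ∉ A ∧ ∃ b ∈ B, x ∈ f b
    · obtain ⟨hxA, b, hb, hxb⟩ := hx
      obtain ⟨p, hp⟩ := exists_infix_pair hxb fun h => hxA ((hA x).2 ⟨b, hb, h⟩)
      exact ⟨p, fun _ => .inl ⟨b, hb, hp⟩⟩
    · exact ⟨x, fun hxA => .inr ⟨rfl, fun b hb hxb => hx ⟨hxA, b, hb, hxb⟩⟩⟩
  choose p hp using hpred
  refine ⟨p, fun x hx => ?_, fun x hx y hy hxy => ?_⟩
  · rcases hp x (by simpa using hx) with ⟨b, hb, h⟩ | ⟨h, h'⟩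
    · have hE : E (p x) x := by
        have : List.IsChain E (f b) := (hf b hb).1
        simpa using this.infix h
      exact ⟨fun hB => hsink _ hB _ hE, .inr hE⟩
    · rw [h]
      exact ⟨fun hB => h' x hB (List.mem_of_getLast? (hf x hB).2.2), .inl rfl⟩
  · have hx' := hp x (by simpa using hx)
    have hy' := hp y (by simpa using hy)
    rw [hxy] at hx'
    have hmem : ∀ {z l}, [p y, z] <:+: l → p y ∈ l := fun h => h.subset (by simp)
    rcases hx' with ⟨b, hb, h⟩ | ⟨h, h'⟩ <;> rcases hy' with ⟨c, hc, k⟩ | ⟨k, k'⟩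
    · obtain rfl : b = c := by
        by_contra hne
        exact hdis b hb c hc hne _ (hmem h) (hmem k)
      exact eq_of_infix_pair (hf b hb).2.1 h k
    · exact absurd (k ▸ hmem h) (k' b hb)
    · exact absurd (h ▸ hmem k) (h' c hc)
    · exact h.symm.trans k

/-- Two points of `B` whose `g`-orbits meet before reaching `A` are equal, and meet at the same
time. -/
lemma iterate_inj [DecidableEq V] [Fintype V] {A B : Finset V} {g : V → V}
    (hgB : ∀ x ∈ Aᶜ, g x ∉ B) (ginj : Set.InjOn g (Aᶜ : Finset V)) :
    ∀ {i j : ℕ} {b c : V}, b ∈ B → c ∈ B → (∀ k < i, g^[k] b ∉ A) → (∀ k < j, g^[k] c ∉ A) →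
      g^[i] b = g^[j] c → i = j ∧ b = c := by
  intro i
  induction i with
  | zero =>
    intro j b c hb hc _ hj h
    cases j with
    | zero => exact ⟨rfl, h⟩
    | succ j =>
      rw [Function.iterate_succ_apply', Function.iterate_zero, id] at h
      exact absurd (h ▸ hb) (hgB _ (by simpa using hj j (by omega)))
  | succ i ih =>
    intro j b c hb hc hi hj h
    cases j with
    | zero =>
      rw [Function.iterate_succ_apply', Function.iterate_zero, id] at h
      exact absurd (h ▸ hc) (hgB _ (by simpa using hi i (by omega)))
    | succ j =>
      rw [Function.iterate_succ_apply', Function.iterate_succ_apply'] at h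
      have := ih hb hc (fun k hk => hi k (by omega)) (fun k hk => hj k (by omega))
        (ginj (by simpa using hi i (by omega)) (by simpa using hj j (by omega)) h)
      exact ⟨by omega, this.2⟩

lemma routable_of_matchable_compl [DecidableEq V] [Fintype V] {E : V → V → Prop} {A B : Finset V}
    (hcard : A.card = B.card) (h : Matchable (linkRel E B) Aᶜ) : Routable E B A := by
  classical
  obtain ⟨g, hg, ginj⟩ := h
  have hgB : ∀ x ∈ Aᶜ, g x ∉ B := fun x hx => (hg x hx).1
  have hex : ∀ b ∈ B, ∃ n, g^[n] b ∈ A := by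
    intro b hb
    by_contra! hcon
    refine not_injective_infinite_finite (fun n => g^[n] b) fun i j hij => ?_
    exact (iterate_inj hgB ginj hb hb (fun k _ => hcon k) (fun k _ => hcon k) hij).1
  have hn : ∀ b ∈ B, ∃ n, g^[n] b ∈ A ∧ ∀ k < n, g^[k] b ∉ A := fun b hb =>
    ⟨Nat.find (hex b hb), Nat.find_spec (hex b hb), fun k hk => Nat.find_min (hex b hb) hk⟩
  choose! n hnA hnlt using hn
  have hinj : ∀ {b c i j}, b ∈ B → c ∈ B → i ≤ n b → j ≤ n c → g^[i] b = g^[j] c →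
      i = j ∧ b = c := fun hb hc hi hj =>
    iterate_inj hgB ginj hb hc (fun k hk => hnlt _ hb k (by omega))
      (fun k hk => hnlt _ hc k (by omega))
  have hhead : ∀ b, (((List.range (n b + 1)).map fun k => g^[k] b).reverse).head? =
      some (g^[n b] b) := fun b => by simp [List.range_succ]
  refine ⟨fun b => ((List.range (n b + 1)).map fun k => g^[k] b).reverse, fun b hb => ⟨?_, ?_, ?_⟩,
    fun b hb c hc hbc v hv hv' => ?_, fun a => ?_⟩
  · change List.IsChain _ _
    rw [List.isChain_reverse, List.isChain_map, List.isChain_range_succ]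
    intro m hm
    have h1 := (hg (g^[m] b) (by simpa using hnlt b hb m hm)).2
    rw [Nat.succ_eq_add_one, Function.iterate_succ_apply']
    refine h1.resolve_left fun h => ?_
    rw [← Function.iterate_succ_apply' g m b] at h
    have := (hinj hb hb (by omega) (by omega) h).1
    omega
  · rw [List.nodup_reverse]
    refine List.Nodup.map_on (fun i hi j hj h => ?_) List.nodup_range
    rw [List.mem_range] at hi hj
    exact (hinj hb hb (by omega) (by omega) h).1
  · simp [List.range_succ_eq_map]
  · simp only [List.mem_reverse, List.mem_map, List.mem_range] at hv hv'
    obtain ⟨i, hi, rfl⟩ := hv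
    obtain ⟨j, hj, h⟩ := hv'
    exact hbc (hinj hb hc (by omega) (by omega) h.symm).2
  · have himg : B.image (fun b => g^[n b] b) = A := by
      apply Finset.eq_of_subset_of_card_le
      · intro x hx
        obtain ⟨b, hb, rfl⟩ := Finset.mem_image.1 hx
        exact hnA b hb
      · rw [hcard, Finset.card_image_of_injOn]
        exact fun b hb c hc h => (hinj hb hc le_rfl le_rfl h).2
    simp only [hhead, Option.some_inj]
    rw [← himg, Finset.mem_image]

/-- The matroid of routable sets, as the dual of a transversal matroid. -/
noncomputable def routingMatroid [DecidableEq V] (E : V → V → Prop) (B : Finset V) : Matroid V :=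
  (transversalMatroid (linkRel E B))✶

lemma routingMatroid_isBase_iff [DecidableEq V] [Fintype V] {E : V → V → Prop} {A B : Finset V}
    (hsink : ∀ b ∈ B, ∀ v, ¬ E b v) : (routingMatroid E B).IsBase A ↔ Routable E B A := by
  have hB : (transversalMatroid (linkRel E B)).IsBase ((Bᶜ : Finset V) : Set V) := by
    refine Matroid.Indep.isBase_of_maximal ?_ fun J hJ hBJ => ?_
    · exact transversalMatroid_indep.2 ⟨id, fun x hx => ⟨by simpa using hx, .inl rfl⟩, by simp⟩
    · lift J to Finset V using J.toFinite
      obtain ⟨f, hf, finj⟩ := transversalMatroid_indep.1 hJ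
      rw [Finset.coe_subset] at hBJ
      rw [Finset.coe_inj]
      refine Finset.eq_of_subset_of_card_le hBJ (Finset.card_le_card_of_injOn f ?_ finj)
      exact fun x hx => by simpa using (hf x hx).1
  rw [routingMatroid, Matroid.dual_isBase_iff (by simp), transversalMatroid_E,
    ← Set.compl_eq_univ_sdiff, ← Finset.coe_compl]
  constructor
  · intro h
    have hcard := h.ncard_eq_ncard_of_isBase hB
    rw [Set.ncard_coe_finset, Set.ncard_coe_finset, Finset.card_compl, Finset.card_compl] at hcard
    have h1 := A.card_le_univ
    have h2 := B.card_le_univ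
    exact routable_of_matchable_compl (by omega) (transversalMatroid_indep.1 h.indep)
  · intro h
    have hcard : (Aᶜ : Finset V).card = (Bᶜ : Finset V).card := by
      rw [Finset.card_compl, Finset.card_compl, card_eq_of_routable h]
    obtain ⟨B', hB', hsub⟩ :=
      (transversalMatroid_indep.2 (h.matchable_compl hsink)).exists_isBase_superset
    have := Set.eq_of_subset_of_ncard_le hsub (by
      rw [hB'.ncard_eq_ncard_of_isBase hB, Set.ncard_coe_finset, Set.ncard_coe_finset, hcard])
    rwa [this]

lemma routingMatroid_indep_iff [DecidableEq V] [Fintype V] {E : V → V → Prop} {I B : Finset V}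
    (hsink : ∀ b ∈ B, ∀ v, ¬ E b v) :
    (routingMatroid E B).Indep I ↔ ∃ A : Finset V, Routable E B A ∧ I ⊆ A := by
  rw [Matroid.indep_iff]
  constructor
  · rintro ⟨A, hA, hIA⟩
    lift A to Finset V using A.toFinite
    exact ⟨A, (routingMatroid_isBase_iff hsink).1 hA, by exact_mod_cast hIA⟩
  · rintro ⟨A, hA, hIA⟩
    exact ⟨A, (routingMatroid_isBase_iff hsink).2 hA, by exact_mod_cast hIA⟩

/-! ### Deleting a set whose maximum linking is trivial -/

lemma pathsKtoB_card {ι : Type*} {E : V → V → Prop} {B K : Finset V} (S : Finset ι)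
    (F : ι → List V)
    (hF : ∀ c ∈ S, (F c).IsChain E ∧ (F c).Nodup ∧
      (∃ a ∈ K, (F c).head? = some a) ∧ (∃ b ∈ B, (F c).getLast? = some b))
    (hdis : ∀ c ∈ S, ∀ d ∈ S, c ≠ d → ∀ v, v ∈ F c → v ∉ F d) : PathsKtoB E B K S.card :=
  ⟨fun t => F (S.equivFin.symm t), fun t => hF _ (S.equivFin.symm t).2, fun s t hst =>
    hdis _ (S.equivFin.symm s).2 _ (S.equivFin.symm t).2 fun h =>
      hst (S.equivFin.symm.injective (Subtype.ext h))⟩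

lemma pathsKtoB_of_routable {E : V → V → Prop} {A B I K : Finset V}
    (hA : Routable E B A) (hIA : I ⊆ A) (hIK : I ⊆ K) : PathsKtoB E B K I.card := by
  obtain ⟨f, hf, hdis, hA⟩ := hA
  have hb : ∀ a ∈ I, ∃ b ∈ B, (f b).head? = some a := fun a ha => (hA a).1 (hIA ha)
  choose! b hbB hbh using hb
  refine pathsKtoB_card I (fun a => f (b a)) (fun a ha => ?_) fun a ha a' ha' hne => ?_
  · have := hf _ (hbB a ha)
    exact ⟨this.1, this.2.1, ⟨a, hIK ha, hbh a ha⟩, b a, hbB a ha, this.2.2⟩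
  · refine hdis _ (hbB a ha) _ (hbB a' ha') fun h => hne ?_
    have := hbh a ha
    rw [h, hbh a' ha'] at this
    exact (Option.some_inj.1 this).symm

lemma eq_singleton_of_head_sink {E : V → V → Prop} {l : List V} {k : V} (hl : l.IsChain E)
    (hk : ∀ v, ¬ E k v) (h : l.head? = some k) : l = [k] := by
  match l, hl, h with
  | [_], _, h => simpa using h
  | x :: y :: l, hl, h =>
    obtain rfl : x = k := by simpa using h
    exact absurd (List.isChain_cons_cons.1 hl).1 (hk y)

lemma notMem_of_isChain_delete {E : V → V → Prop} {K : Finset V} {l : List V}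
    (hl : l.IsChain fun x y => x ∉ K ∧ y ∉ K ∧ E x y) {b : V} (hb : l.getLast? = some b)
    (hbK : b ∉ K) : ∀ v ∈ l, v ∉ K := by
  induction l with
  | nil => simp
  | cons x l ih =>
    cases l with
    | nil =>
      obtain rfl : x = b := by simpa using hb
      simpa using hbK
    | cons y l =>
      rw [List.isChain_cons_cons] at hl
      rw [List.getLast?_cons_cons] at hb
      intro v hv
      rcases List.mem_cons.1 hv with rfl | hv
      · exact hl.1.1
      · exact ih hl.2 hb v hv

/-- Routings of the graph with `K` deleted extend by the trivial paths at `K ∩ B`. -/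
lemma routable_union_of_routable_delete [DecidableEq V] {E : V → V → Prop} {A B K : Finset V}
    (h : Routable (fun x y => x ∉ K ∧ y ∉ K ∧ E x y) (B \ K) A) :
    Disjoint K A ∧ Routable E B (A ∪ K ∩ B) := by
  obtain ⟨f, hf, hdis, hA⟩ := h
  have havoid : ∀ b ∈ B, b ∉ K → ∀ v ∈ f b, v ∉ K := fun b hb hbK =>
    have := hf b (Finset.mem_sdiff.2 ⟨hb, hbK⟩)
    notMem_of_isChain_delete this.1 this.2.2 hbK
  refine ⟨Finset.disjoint_right.2 fun a ha => ?_, fun b => if b ∈ K then [b] else f b,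
    fun b hb => ?_, fun b hb c hc hbc v hv => ?_, fun a => ?_⟩
  · obtain ⟨b, hb, h⟩ := (hA a).1 ha
    rw [Finset.mem_sdiff] at hb
    exact havoid b hb.1 hb.2 a (List.mem_of_mem_head? h)
  · by_cases hbK : b ∈ K
    · simp only [hbK, if_true]
      exact ⟨List.isChain_singleton b, by simp, by simp⟩
    · simp only [hbK, if_false]
      have := hf b (Finset.mem_sdiff.2 ⟨hb, hbK⟩)
      exact ⟨List.IsChain.imp (fun _ _ h => h.2.2) this.1, this.2⟩
  · by_cases hbK : b ∈ K <;> by_cases hcK : c ∈ K <;> simp only [hbK, hcK, if_true, if_false] at hv ⊢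
    · simp_all
    · intro hvc
      rw [List.mem_singleton] at hv
      exact havoid c hc hcK v hvc (hv ▸ hbK)
    · intro hvc
      rw [List.mem_singleton] at hvc
      exact havoid b hb hbK v hv (hvc ▸ hcK)
    · exact hdis b (by simp [hb, hbK]) c (by simp [hc, hcK]) hbc v hv
  · rw [Finset.mem_union, hA, Finset.mem_inter]
    constructor
    · rintro (⟨b, hb, h⟩ | ⟨hK, hB⟩)
      · rw [Finset.mem_sdiff] at hb
        exact ⟨b, hb.1, by simpa [hb.2] using h⟩
      · exact ⟨a, hB, by simp [hK]⟩
    · rintro ⟨b, hb, h⟩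
      by_cases hbK : b ∈ K
      · obtain rfl : b = a := by simpa [hbK] using h
        exact .inr ⟨hbK, hb⟩
      · exact .inl ⟨b, by simp [hb, hbK], by simpa [hbK] using h⟩

/-- If `K ∩ B` is a maximum linked subset of `K`, then a routing from `A ∪ K ∩ B` has no further
vertices in `K`. -/
lemma routable_delete_of_routable_union [DecidableEq V] {E : V → V → Prop} {A B K : Finset V}
    (hsink : ∀ b ∈ B, ∀ v, ¬ E b v) (hK : ¬ PathsKtoB E B K ((K ∩ B).card + 1))
    (hAK : Disjoint K A) (h : Routable E B (A ∪ K ∩ B)) :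
    Routable (fun x y => x ∉ K ∧ y ∉ K ∧ E x y) (B \ K) A := by
  obtain ⟨f, hf, hdis, hA⟩ := h
  have hsing : ∀ k ∈ K ∩ B, f k = [k] := by
    intro k hk
    obtain ⟨b, hb, h⟩ := (hA k).1 (Finset.mem_union_right _ hk)
    have h1 := eq_singleton_of_head_sink (hf b hb).1 (hsink k (Finset.mem_inter.1 hk).2) h
    obtain rfl : k = b := by simpa [h1] using (hf b hb).2.2
    exact h1
  have havoid : ∀ b ∈ B, b ∉ K → ∀ v ∈ f b, v ∉ K := by
    intro b hb hbK v hv hvK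
    apply hK
    obtain ⟨s, t, hst⟩ := List.append_of_mem hv
    have hsuf : v :: t <:+ f b := ⟨s, hst.symm⟩
    rw [← Finset.card_insert_of_notMem (show b ∉ K ∩ B by simp [hbK])]
    have hmem : ∀ c ∈ insert b (K ∩ B), c ∈ B := by
      intro c hc
      rcases Finset.mem_insert.1 hc with rfl | hc
      exacts [hb, (Finset.mem_inter.1 hc).2]
    have hsub : ∀ c, (if c = b then v :: t else f c) ⊆ f c := by
      intro c
      split_ifs with h
      · exact h ▸ hsuf.subset
      · exact List.Subset.refl _
    refine pathsKtoB_card _ (fun c => if c = b then v :: t else f c) (fun c hc => ?_)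
      fun c hc d hd hcd w hw hw' => hdis c (hmem c hc) d (hmem d hd) hcd w (hsub c hw) (hsub d hw')
    rcases Finset.mem_insert.1 hc with rfl | hc
    · simp only [if_true]
      refine ⟨List.IsChain.suffix (hf c hb).1 hsuf, (hf c hb).2.1.sublist hsuf.sublist,
        ⟨v, hvK, rfl⟩, c, hb, ?_⟩
      rw [← (hf c hb).2.2, hst, List.getLast?_append_of_ne_nil _ (by simp)]
    · have hcb : c ≠ b := fun h => hbK (h ▸ (Finset.mem_inter.1 hc).1)
      simp only [hcb, if_false, hsing c hc]
      exact ⟨List.isChain_singleton c, by simp, ⟨c, (Finset.mem_inter.1 hc).1, rfl⟩, c,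
        (Finset.mem_inter.1 hc).2, rfl⟩
  refine ⟨f, fun b hb => ?_, fun b hb c hc => ?_, fun a => ?_⟩
  · rw [Finset.mem_sdiff] at hb
    refine ⟨List.IsChain.imp_of_mem_imp (fun x y hx hy h => ?_) (hf b hb.1).1, (hf b hb.1).2⟩
    exact ⟨havoid b hb.1 hb.2 x hx, havoid b hb.1 hb.2 y hy, h⟩
  · exact hdis b (Finset.mem_sdiff.1 hb).1 c (Finset.mem_sdiff.1 hc).1
  · constructor
    · intro ha
      obtain ⟨b, hb, h⟩ := (hA a).1 (Finset.mem_union_left _ ha)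
      refine ⟨b, Finset.mem_sdiff.2 ⟨hb, fun hbK => ?_⟩, h⟩
      rw [hsing b (Finset.mem_inter.2 ⟨hbK, hb⟩)] at h
      obtain rfl : b = a := by simpa using h
      exact Finset.disjoint_left.1 hAK hbK ha
    · rintro ⟨b, hb, h⟩
      rw [Finset.mem_sdiff] at hb
      have haK := havoid b hb.1 hb.2 a (List.mem_of_mem_head? h)
      rcases Finset.mem_union.1 ((hA a).2 ⟨b, hb.1, h⟩) with h | h
      exacts [h, absurd (Finset.mem_inter.1 h).1 haK]

end

/-- Let `(G,B)` be a planted graph whose routable sets are the bases of the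
matroid `M = L(G,B)`, and let `K ⊆ V` satisfy `|K ∩ B| = r(K)`, where `r(K)` is
the maximum number of pairwise vertex-disjoint directed paths from `K` to `B`.
Fix a maximal independent subset `BK` of `K` (a subset of `K` contained in some
routable set, maximal with this property), so that the bases of the contraction
`M/K` are the sets `A'' ⊆ V − K` with `A'' ∪ BK` routable.  Let `(G'',B'')` be
obtained from `(G,B)` by deleting the vertices of `K` and all edges incident to
them, with `B'' = B − K`.  Then the routable sets of `(G'',B'')` are exactly the
bases of `M/K`; in particular, `M/K` is cotransversal. -/
theorem contraction_presentation {V : Type*} [DecidableEq V] [Fintype V]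
    (E : V → V → Prop) (B : Finset V) (hPl : IsPlanted E B)
    (hne : ∃ A : Finset V, Routable E B A)
    (K : Finset V) (rK : ℕ)
    (hrK : IsGreatest {m : ℕ | PathsKtoB E B K m} rK)
    (hKB : (K ∩ B).card = rK)
    (BK : Finset V) (hBKsub : BK ⊆ K)
    (hBKind : ∃ A : Finset V, Routable E B A ∧ BK ⊆ A)
    (hBKmax : ∀ I : Finset V, I ⊆ K → (∃ A : Finset V, Routable E B A ∧ I ⊆ A) →
      BK ⊆ I → I = BK)
    (A'' : Finset V) :
    Routable (fun x y => x ∉ K ∧ y ∉ K ∧ E x y) (B \ K) A''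
      ↔ (A'' ⊆ Kᶜ ∧ Routable E B (A'' ∪ BK)) := by
  have hsink := hPl.2
  have hroutB : Routable E B B :=
    ⟨fun b => [b], fun b _ => ⟨List.isChain_singleton b, by simp, by simp⟩,
      fun b _ c _ hbc v hv => by simp_all, fun a => by simp⟩
  have hle : ∀ {m}, PathsKtoB E B K m → m ≤ rK := fun h => hrK.2 h
  have hKBbasis : (routingMatroid E B).IsBasis ((K ∩ B : Finset V) : Set V) (K : Set V) := by
    refine Matroid.Indep.isBasis_of_maximal_subset ?_ ?_ ?_ (Set.subset_univ _)
    · exact (routingMatroid_indep_iff hsink).2 ⟨B, hroutB, Finset.inter_subset_right⟩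
    · exact_mod_cast Finset.inter_subset_left
    · intro J hJ hIJ hJK
      lift J to Finset V using J.toFinite
      rw [Finset.coe_subset] at hIJ hJK
      obtain ⟨A, hA, hJA⟩ := (routingMatroid_indep_iff hsink).1 hJ
      have := hle (pathsKtoB_of_routable hA hJA hJK)
      rw [Finset.eq_of_subset_of_card_le hIJ (by omega)]
  have hBKbasis : (routingMatroid E B).IsBasis (BK : Set V) (K : Set V) := by
    refine Matroid.Indep.isBasis_of_maximal_subset ?_ (by exact_mod_cast hBKsub) ?_
      (Set.subset_univ _)
    · exact (routingMatroid_indep_iff hsink).2 hBKind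
    · intro J hJ hIJ hJK
      lift J to Finset V using J.toFinite
      rw [hBKmax J (by exact_mod_cast hJK) ((routingMatroid_indep_iff hsink).1 hJ)
        (by exact_mod_cast hIJ)]
  have hiff : Disjoint K A'' → (Routable E B (A'' ∪ K ∩ B) ↔ Routable E B (A'' ∪ BK)) := by
    intro hdis
    rw [← routingMatroid_isBase_iff hsink, ← routingMatroid_isBase_iff hsink, Finset.coe_union,
      Finset.coe_union]
    exact isBase_congr_of_isBasis hKBbasis hBKbasis (by exact_mod_cast hdis)
  rw [Finset.subset_compl_comm, Finset.subset_compl_iff_disjoint_right]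
  constructor
  · intro h
    obtain ⟨hdis, hA⟩ := routable_union_of_routable_delete h
    exact ⟨hdis, (hiff hdis).1 hA⟩
  · rintro ⟨hdis, hA⟩
    refine routable_delete_of_routable_union hsink (fun h => ?_) hdis ((hiff hdis).2 hA)
    have := hle h
    omega
end

section
/- Let (G,B) be a planted graph with at least one routable set, and let (G̅,B) be its saturation. Then the set L of loops of L(G,B) (the vertices contained in no routable set) forms a complete directed subgraph of G̅: for any two distinct loops u, w ∈ L with u ∉ B, the edge e_{uw} belongs to G̅; moreover no edge of G̅ goes from a loop to a non-loop. -/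
/-- `Ebar` is (the edge relation of) the saturation of the planted graph `(E,B)`:
the unique maximal planted graph containing `(E,B)`, with the same sink set `B`
and the same routable sets. -/
def IsSaturation {V : Type*} [DecidableEq V] [Fintype V]
    (E : V → V → Prop) (B : Finset V) (Ebar : V → V → Prop) : Prop :=
  (∀ x y, E x y → Ebar x y) ∧
  IsPlanted Ebar B ∧
  (∀ A : Finset V, Routable Ebar B A ↔ Routable E B A) ∧
  (∀ E' : V → V → Prop, (∀ x y, Ebar x y → E' x y) → IsPlanted E' B →
    (∀ A : Finset V, Routable E' B A ↔ Routable E B A) →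
    ∀ x y, E' x y ↔ Ebar x y)

theorem Relation.reflTransGen_of_mem_isChain {V : Type*} {E : V → V → Prop} {b : V} {l : List V}
    (hl : l.IsChain E) (hb : l.getLast? = some b) {x : V} (hx : x ∈ l) :
    Relation.ReflTransGen E x b := by
  induction l generalizing x with
  | nil => simp at hx
  | cons a t ih =>
    cases t with
    | nil => simp_all [Relation.ReflTransGen.refl]
    | cons c t =>
      rw [List.isChain_cons_cons] at hl
      rw [List.getLast?_cons_cons] at hb
      rcases List.mem_cons.1 hx with rfl | hx
      · exact (ih hl.2 hb List.mem_cons_self).head hl.1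
      · exact ih hl.2 hb hx

theorem IsPlanted.exists_nodup_isChain {V : Type*} {E : V → V → Prop} {B : Finset V}
    (hE : IsPlanted E B) {x b : V} (h : Relation.ReflTransGen E x b) :
    ∃ l : List V, l.IsChain E ∧ l.Nodup ∧ l.getLast? = some b ∧ l.head? = some x ∧
      ∀ v ∈ l, v ∈ B → v = b := by
  induction h using Relation.ReflTransGen.head_induction_on with
  | refl => exact ⟨[b], by simp⟩
  | @head x y hxy _ ih =>
    obtain ⟨l, hc, hn, hlast, hhead, hB⟩ := ih
    by_cases hx : x ∈ l
    · obtain ⟨s, t, rfl⟩ := List.append_of_mem hx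
      refine ⟨x :: t, (List.isChain_append.1 hc).2.1, (List.nodup_append.1 hn).2.1, ?_, rfl,
        fun v hv => hB v (List.mem_append_right _ hv)⟩
      simpa using hlast
    · cases l with
      | nil => simp at hhead
      | cons z t =>
        obtain rfl : z = y := by simpa using hhead
        refine ⟨x :: z :: t, List.isChain_cons_cons.2 ⟨hxy, hc⟩, List.nodup_cons.2 ⟨hx, hn⟩,
          by rw [List.getLast?_cons_cons, hlast], rfl, fun v hv hvB => ?_⟩
        rcases List.mem_cons.1 hv with rfl | hv
        · exact absurd hxy (hE.2 _ hvB _)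
        · exact hB v hv hvB

/-- A vertex is a loop of the cotransversal matroid exactly when no directed path joins it
to the sink set. -/
theorem IsPlanted.forall_notMem_routable_iff {V : Type*} [DecidableEq V] {E : V → V → Prop}
    {B : Finset V} (hE : IsPlanted E B) (x : V) :
    (∀ A : Finset V, Routable E B A → x ∉ A) ↔ ∀ b ∈ B, ¬ Relation.ReflTransGen E x b := by
  constructor
  · intro h b hb hxb
    obtain ⟨l, hc, hn, hlast, hhead, hB⟩ := hE.exists_nodup_isChain hxb
    refine h (insert x (B.erase b)) ⟨fun c => if c = b then l else [c], ?_, ?_, ?_⟩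
      (Finset.mem_insert_self _ _)
    · intro c _
      by_cases hcb : c = b
      · subst hcb
        simpa using ⟨hc, hn, hlast⟩
      · simp only [hcb, if_false]
        exact ⟨List.isChain_singleton c, List.nodup_singleton c, rfl⟩
    · intro c hcB d hdB hcd v hvc hvd
      by_cases h₁ : c = b <;> by_cases h₂ : d = b <;> simp only [h₁, h₂, if_true, if_false,
        List.mem_singleton] at hvc hvd
      · exact hcd (h₁.trans h₂.symm)
      · exact h₂ (hB d (hvd ▸ hvc) hdB)
      · exact h₁ (hB c (hvc ▸ hvd) hcB)
      · exact hcd (hvc.symm.trans hvd)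
    · intro a
      simp only [Finset.mem_insert, Finset.mem_erase]
      constructor
      · rintro (rfl | ⟨hab, haB⟩)
        · exact ⟨b, hb, by simpa using hhead⟩
        · exact ⟨a, haB, by simp [hab]⟩
      · rintro ⟨c, hcB, hca⟩
        by_cases hcb : c = b
        · simp only [hcb, if_true, hhead, Option.some.injEq] at hca
          exact Or.inl hca.symm
        · simp only [hcb, if_false, List.head?_cons, Option.some.injEq] at hca
          exact Or.inr (hca ▸ ⟨hcb, hcB⟩)
  · rintro h A ⟨f, hf, _, hA⟩ hx
    obtain ⟨b, hb, hxb⟩ := (hA x).1 hx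
    exact h b hb (Relation.reflTransGen_of_mem_isChain (hf b hb).1 (hf b hb).2.2
      (List.mem_of_mem_head? hxb))

theorem Routable.mono {V : Type*} {E E' : V → V → Prop} {B A : Finset V}
    (h : ∀ x y, E x y → ∀ b ∈ B, Relation.ReflTransGen E y b → E' x y)
    (hA : Routable E B A) : Routable E' B A := by
  obtain ⟨f, hf, hdisj, hA⟩ := hA
  refine ⟨f, fun b hb => ⟨?_, (hf b hb).2⟩, hdisj, hA⟩
  have hc : (f b).IsChain E := (hf b hb).1
  have hlast := (hf b hb).2.2
  have key : ∀ l : List V, l.IsChain E → l.getLast? = some b → l.IsChain E' := by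
    intro l hl hlb
    induction l with
    | nil => simp
    | cons a t ih =>
      cases t with
      | nil => simp
      | cons c t =>
        rw [List.isChain_cons_cons] at hl ⊢
        rw [List.getLast?_cons_cons] at hlb
        exact ⟨h a c hl.1 b hb
          (Relation.reflTransGen_of_mem_isChain hl.2 hlb List.mem_cons_self), ih hl.2 hlb⟩
  exact key _ hc hlast

/-- Let `(G,B)` be a planted graph with at least one routable set and with
saturation `(G̅,B)`.  The loops of `L(G,B)` (vertices in no routable set) form a
complete directed subgraph of `G̅`: for any two distinct loops `u, w` with
`u ∉ B` the edge `e_{uw}` belongs to `G̅`; moreover no edge of `G̅` goes from a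
loop to a non-loop. -/
theorem loops_complete_in_saturation {V : Type*} [DecidableEq V] [Fintype V]
    (E : V → V → Prop) (B : Finset V) (hPl : IsPlanted E B)
    (hne : ∃ A : Finset V, Routable E B A)
    (Ebar : V → V → Prop) (hsat : IsSaturation E B Ebar) :
    (∀ u w : V, (∀ A : Finset V, Routable E B A → u ∉ A) →
      (∀ A : Finset V, Routable E B A → w ∉ A) →
      u ≠ w → u ∉ B → Ebar u w) ∧
    (∀ u w : V, (∀ A : Finset V, Routable E B A → u ∉ A) →
      ¬ (∀ A : Finset V, Routable E B A → w ∉ A) → ¬ Ebar u w) := by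
  have hloop : ∀ x, (∀ A : Finset V, Routable E B A → x ∉ A) ↔
      ∀ b ∈ B, ¬ Relation.ReflTransGen Ebar x b := by
    intro x
    rw [← hsat.2.1.forall_notMem_routable_iff]
    simp only [hsat.2.2.1]
  simp only [hloop]
  obtain ⟨-, hPbar, hroute, hmax⟩ := hsat
  constructor
  · intro u w _ hw huw huB
    refine (hmax (fun x y => Ebar x y ∨ (x = u ∧ y = w)) (fun _ _ => Or.inl) ⟨?_, ?_⟩ ?_ u w).1
      (Or.inr ⟨rfl, rfl⟩)
    · rintro v (h | ⟨rfl, rfl⟩)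
      · exact hPbar.1 v h
      · exact huw rfl
    · rintro b hb v (h | ⟨rfl, -⟩)
      · exact hPbar.2 b hb v h
      · exact huB hb
    · have hreach : ∀ b ∈ B, ∀ x,
          Relation.ReflTransGen (fun x y => Ebar x y ∨ (x = u ∧ y = w)) x b →
            Relation.ReflTransGen Ebar x b := by
        intro b hb x hx
        induction hx using Relation.ReflTransGen.head_induction_on with
        | refl => exact .refl
        | head hxy _ ih =>
          rcases hxy with h | ⟨-, rfl⟩
          · exact ih.head h
          · exact absurd ih (hw b hb)
      intro A
      rw [← hroute]
      refine ⟨Routable.mono ?_, Routable.mono fun _ _ h _ _ _ => Or.inl h⟩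
      rintro x y (h | ⟨-, rfl⟩) b hb hy
      · exact h
      · exact absurd (hreach b hb _ hy) (hw b hb)
  · intro u w hu hw huw
    push Not at hw
    obtain ⟨b, hb, hwb⟩ := hw
    exact hu b hb (hwb.head huw)
end
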